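/- arXiv:math-ph/0506072 — 4 statements merged into one kernel-verified Lean document; each statement's English description precedes it below -/
import Mathlib

section
/- Let (F,G) be a generating pair on Ω with F, G continuously differentiable, and let φ, ψ : Ω → ℂ be continuously differentiable, W = φ·F + ψ·G. Then the identity (∂̄φ)·F + (∂̄ψ)·G = 0 holds at a point of Ω if and only if ∂̄W = a_(F,G)·W + b_(F,G)·W̄ holds there; and at such a point one also has ∂W − A_(F,G)·W − B_(F,G)·W̄ = (∂φ)·F + (∂ψ)·G. -/
open MeasureTheory

/-- Bicomplex numbers: `q = q0 + q1·k` with `q0, q1 : ℂ`, `k² = -1`, `ik = ki`. -/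
structure Bicomplex : Type where
  re : ℂ
  im : ℂ

namespace Bicomplex

instance : Zero Bicomplex := ⟨⟨0, 0⟩⟩
instance : One Bicomplex := ⟨⟨1, 0⟩⟩
instance : Add Bicomplex := ⟨fun p q => ⟨p.re + q.re, p.im + q.im⟩⟩
instance : Neg Bicomplex := ⟨fun p => ⟨-p.re, -p.im⟩⟩
instance : Sub Bicomplex := ⟨fun p q => ⟨p.re - q.re, p.im - q.im⟩⟩
instance : Mul Bicomplex := ⟨fun p q => ⟨p.re * q.re - p.im * q.im, p.re * q.im + p.im * q.re⟩⟩

/-- bicomplex conjugation `q0 + q1·k ↦ q0 - q1·k` -/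
def conj (q : Bicomplex) : Bicomplex := ⟨q.re, -q.im⟩

/-- the second imaginary unit `k` -/
def k : Bicomplex := ⟨0, 1⟩

/-- embedding of ℂ into the bicomplex numbers -/
def ofC (z : ℂ) : Bicomplex := ⟨z, 0⟩

/-- bicomplex inverse: `q⁻¹ = q̄/(q0² + q1²)` (junk value if not invertible) -/
noncomputable def inv (q : Bicomplex) : Bicomplex :=
  ⟨q.re / (q.re ^ 2 + q.im ^ 2), -q.im / (q.re ^ 2 + q.im ^ 2)⟩

/-- the set 𝔖 of bicomplex zero divisors: nonzero `q` with `q·q̄ = q0² + q1² = 0` -/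
def zeroDivSet : Set Bicomplex := {q | q ≠ 0 ∧ q.re ^ 2 + q.im ^ 2 = 0}

end Bicomplex

/-- ∂/∂x of a complex-valued function on ℝ² -/
noncomputable def pdx (f : ℝ × ℝ → ℂ) (p : ℝ × ℝ) : ℂ := deriv (fun t => f (t, p.2)) p.1
/-- ∂/∂y of a complex-valued function on ℝ² -/
noncomputable def pdy (f : ℝ × ℝ → ℂ) (p : ℝ × ℝ) : ℂ := deriv (fun t => f (p.1, t)) p.2
/-- Laplacian Δ = ∂²/∂x² + ∂²/∂y² of a complex-valued function on ℝ² -/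
noncomputable def lap (f : ℝ × ℝ → ℂ) (p : ℝ × ℝ) : ℂ := pdx (pdx f) p + pdy (pdy f) p

/-- ∂/∂x of a bicomplex-valued function on ℝ² (componentwise) -/
noncomputable def bpdx (F : ℝ × ℝ → Bicomplex) (p : ℝ × ℝ) : Bicomplex :=
  ⟨pdx (fun q => (F q).re) p, pdx (fun q => (F q).im) p⟩
/-- ∂/∂y of a bicomplex-valued function on ℝ² (componentwise) -/
noncomputable def bpdy (F : ℝ × ℝ → Bicomplex) (p : ℝ × ℝ) : Bicomplex :=
  ⟨pdy (fun q => (F q).re) p, pdy (fun q => (F q).im) p⟩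

/-- `∂̄ = ∂/∂x + k·∂/∂y` -/
noncomputable def dbar (F : ℝ × ℝ → Bicomplex) (p : ℝ × ℝ) : Bicomplex :=
  bpdx F p + Bicomplex.k * bpdy F p

/-- `∂ = ∂/∂x − k·∂/∂y` -/
noncomputable def dz (F : ℝ × ℝ → Bicomplex) (p : ℝ × ℝ) : Bicomplex :=
  bpdx F p - Bicomplex.k * bpdy F p

/-- continuity of a bicomplex-valued function (componentwise) -/
def BContinuousOn (F : ℝ × ℝ → Bicomplex) (Ω : Set (ℝ × ℝ)) : Prop :=
  ContinuousOn (fun p => (F p).re) Ω ∧ ContinuousOn (fun p => (F p).im) Ω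

/-- `C^n` smoothness of a bicomplex-valued function (componentwise) -/
def BContDiffOn (n : ℕ∞) (F : ℝ × ℝ → Bicomplex) (Ω : Set (ℝ × ℝ)) : Prop :=
  ContDiffOn ℝ n (fun p => (F p).re) Ω ∧ ContDiffOn ℝ n (fun p => (F p).im) Ω

/-- characteristic coefficient `a_(F,G)` -/
noncomputable def aCoef (F G : ℝ × ℝ → Bicomplex) (z : ℝ × ℝ) : Bicomplex :=
  -((Bicomplex.conj (F z) * dbar G z - dbar F z * Bicomplex.conj (G z)) *
    Bicomplex.inv (F z * Bicomplex.conj (G z) - Bicomplex.conj (F z) * G z))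
/-- characteristic coefficient `b_(F,G)` -/
noncomputable def bCoef (F G : ℝ × ℝ → Bicomplex) (z : ℝ × ℝ) : Bicomplex :=
  (F z * dbar G z - dbar F z * G z) *
    Bicomplex.inv (F z * Bicomplex.conj (G z) - Bicomplex.conj (F z) * G z)
/-- characteristic coefficient `A_(F,G)` -/
noncomputable def ACoef (F G : ℝ × ℝ → Bicomplex) (z : ℝ × ℝ) : Bicomplex :=
  -((Bicomplex.conj (F z) * dz G z - dz F z * Bicomplex.conj (G z)) *
    Bicomplex.inv (F z * Bicomplex.conj (G z) - Bicomplex.conj (F z) * G z))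
/-- characteristic coefficient `B_(F,G)` -/
noncomputable def BCoef (F G : ℝ × ℝ → Bicomplex) (z : ℝ × ℝ) : Bicomplex :=
  (F z * dz G z - dz F z * G z) *
    Bicomplex.inv (F z * Bicomplex.conj (G z) - Bicomplex.conj (F z) * G z)

/-- `(F,G)` is a generating pair on `Ω` -/
def IsGeneratingPair (F G : ℝ × ℝ → Bicomplex) (Ω : Set (ℝ × ℝ)) : Prop :=
  BContDiffOn 1 F Ω ∧ BContDiffOn 1 G Ω ∧
    ∀ z ∈ Ω, (Bicomplex.conj (F z) * G z).im ≠ 0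

namespace Bicomplex

@[ext]
theorem ext {p q : Bicomplex} (hre : p.re = q.re) (him : p.im = q.im) : p = q := by
  cases p
  cases q
  simp_all

@[simp] theorem zero_re : (0 : Bicomplex).re = 0 := rfl
@[simp] theorem zero_im : (0 : Bicomplex).im = 0 := rfl
@[simp] theorem one_re : (1 : Bicomplex).re = 1 := rfl
@[simp] theorem one_im : (1 : Bicomplex).im = 0 := rfl
@[simp] theorem add_re (p q : Bicomplex) : (p + q).re = p.re + q.re := rfl
@[simp] theorem add_im (p q : Bicomplex) : (p + q).im = p.im + q.im := rfl
@[simp] theorem neg_re (p : Bicomplex) : (-p).re = -p.re := rfl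
@[simp] theorem neg_im (p : Bicomplex) : (-p).im = -p.im := rfl
@[simp] theorem sub_re (p q : Bicomplex) : (p - q).re = p.re - q.re := rfl
@[simp] theorem sub_im (p q : Bicomplex) : (p - q).im = p.im - q.im := rfl
@[simp] theorem mul_re (p q : Bicomplex) : (p * q).re = p.re * q.re - p.im * q.im := rfl
@[simp] theorem mul_im (p q : Bicomplex) : (p * q).im = p.re * q.im + p.im * q.re := rfl
@[simp] theorem conj_re (q : Bicomplex) : (conj q).re = q.re := rfl
@[simp] theorem conj_im (q : Bicomplex) : (conj q).im = -q.im := rfl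
@[simp] theorem ofC_re (c : ℂ) : (ofC c).re = c := rfl
@[simp] theorem ofC_im (c : ℂ) : (ofC c).im = 0 := rfl

instance : CommRing Bicomplex where
  add_assoc _ _ _ := by ext <;> simp <;> ring
  zero_add _ := by ext <;> simp
  add_zero _ := by ext <;> simp
  add_comm _ _ := by ext <;> simp <;> ring
  neg_add_cancel _ := by ext <;> simp
  sub_eq_add_neg _ _ := by ext <;> simp <;> ring
  mul_assoc _ _ _ := by ext <;> simp <;> ring
  one_mul _ := by ext <;> simp
  mul_one _ := by ext <;> simp
  mul_comm _ _ := by ext <;> simp <;> ring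
  left_distrib _ _ _ := by ext <;> simp <;> ring
  right_distrib _ _ _ := by ext <;> simp <;> ring
  zero_mul _ := by ext <;> simp
  mul_zero _ := by ext <;> simp
  nsmul := nsmulRec
  zsmul := zsmulRec

theorem conj_ofC_mul_add (c d : ℂ) (p q : Bicomplex) :
    conj (ofC c * p + ofC d * q) = ofC c * conj p + ofC d * conj q := by
  ext <;> simp [add_comm]

theorem mul_inv_cancel_of_sq_add_sq_ne_zero {q : Bicomplex} (h : q.re ^ 2 + q.im ^ 2 ≠ 0) :
    q * inv q = 1 := by
  ext <;> simp [inv] <;> field_simp <;> ring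

/-- The denominator of the characteristic coefficients is invertible. -/
theorem mul_conj_sub_conj_mul_mul_inv {p q : Bicomplex} (h : (conj p * q).im ≠ 0) :
    (p * conj q - conj p * q) * inv (p * conj q - conj p * q) = 1 := by
  apply mul_inv_cancel_of_sq_add_sq_ne_zero
  have key : (p * conj q - conj p * q).re ^ 2 + (p * conj q - conj p * q).im ^ 2 =
      4 * (conj p * q).im ^ 2 := by
    simp
    ring
  rw [key]
  exact mul_ne_zero (by norm_num) (pow_ne_zero 2 h)

/-- The pair `a = -(p̄ v - u q̄) / (p q̄ - p̄ q)`, `b = (p v - u q) / (p q̄ - p̄ q)` solves the linear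
system `a p + b p̄ = u`, `a q + b q̄ = v`; this is stated for combinations `c p + d q` with complex
coefficients. -/
theorem characteristic_combination {p q : Bicomplex} (h : (conj p * q).im ≠ 0)
    (u v : Bicomplex) (c d : ℂ) :
    -((conj p * v - u * conj q) * inv (p * conj q - conj p * q)) * (ofC c * p + ofC d * q) +
        (p * v - u * q) * inv (p * conj q - conj p * q) * conj (ofC c * p + ofC d * q) =
      ofC c * u + ofC d * v := by
  rw [conj_ofC_mul_add]
  linear_combination (ofC c * u + ofC d * v) * mul_conj_sub_conj_mul_mul_inv h

end Bicomplex

theorem DifferentiableAt.comp_prodMk_left {f : ℝ × ℝ → ℂ} {z : ℝ × ℝ}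
    (hf : DifferentiableAt ℝ f z) : DifferentiableAt ℝ (fun t => f (t, z.2)) z.1 :=
  DifferentiableAt.comp (f := fun t : ℝ => (t, z.2)) z.1 hf (by fun_prop)

theorem DifferentiableAt.comp_prodMk_right {f : ℝ × ℝ → ℂ} {z : ℝ × ℝ}
    (hf : DifferentiableAt ℝ f z) : DifferentiableAt ℝ (fun t => f (z.1, t)) z.2 :=
  DifferentiableAt.comp (f := fun t : ℝ => (z.1, t)) z.2 hf (by fun_prop)

section PartialDerivatives

variable {f g φ ψ : ℝ × ℝ → ℂ} {z : ℝ × ℝ}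

theorem pdx_const (c : ℂ) : pdx (fun _ => c) z = 0 := by
  simp [pdx]

theorem pdy_const (c : ℂ) : pdy (fun _ => c) z = 0 := by
  simp [pdy]

theorem pdx_mul_add_mul (hφ : DifferentiableAt ℝ φ z) (hf : DifferentiableAt ℝ f z)
    (hψ : DifferentiableAt ℝ ψ z) (hg : DifferentiableAt ℝ g z) :
    pdx (fun ζ => φ ζ * f ζ + ψ ζ * g ζ) z =
      pdx φ z * f z + φ z * pdx f z + (pdx ψ z * g z + ψ z * pdx g z) :=
  ((hφ.comp_prodMk_left.hasDerivAt.mul hf.comp_prodMk_left.hasDerivAt).add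
    (hψ.comp_prodMk_left.hasDerivAt.mul hg.comp_prodMk_left.hasDerivAt)).deriv

theorem pdy_mul_add_mul (hφ : DifferentiableAt ℝ φ z) (hf : DifferentiableAt ℝ f z)
    (hψ : DifferentiableAt ℝ ψ z) (hg : DifferentiableAt ℝ g z) :
    pdy (fun ζ => φ ζ * f ζ + ψ ζ * g ζ) z =
      pdy φ z * f z + φ z * pdy f z + (pdy ψ z * g z + ψ z * pdy g z) :=
  ((hφ.comp_prodMk_right.hasDerivAt.mul hf.comp_prodMk_right.hasDerivAt).add
    (hψ.comp_prodMk_right.hasDerivAt.mul hg.comp_prodMk_right.hasDerivAt)).deriv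

variable {F G : ℝ × ℝ → Bicomplex}

open Bicomplex

theorem bpdx_ofC_mul_add (hφ : DifferentiableAt ℝ φ z) (hψ : DifferentiableAt ℝ ψ z)
    (hF₀ : DifferentiableAt ℝ (fun ζ => (F ζ).re) z)
    (hF₁ : DifferentiableAt ℝ (fun ζ => (F ζ).im) z)
    (hG₀ : DifferentiableAt ℝ (fun ζ => (G ζ).re) z)
    (hG₁ : DifferentiableAt ℝ (fun ζ => (G ζ).im) z) :
    bpdx (fun ζ => ofC (φ ζ) * F ζ + ofC (ψ ζ) * G ζ) z =
      bpdx (fun ζ => ofC (φ ζ)) z * F z + ofC (φ z) * bpdx F z +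
        (bpdx (fun ζ => ofC (ψ ζ)) z * G z + ofC (ψ z) * bpdx G z) := by
  ext
  · simp [bpdx, pdx_const, pdx_mul_add_mul hφ hF₀ hψ hG₀]
  · simp [bpdx, pdx_const, pdx_mul_add_mul hφ hF₁ hψ hG₁]

theorem bpdy_ofC_mul_add (hφ : DifferentiableAt ℝ φ z) (hψ : DifferentiableAt ℝ ψ z)
    (hF₀ : DifferentiableAt ℝ (fun ζ => (F ζ).re) z)
    (hF₁ : DifferentiableAt ℝ (fun ζ => (F ζ).im) z)
    (hG₀ : DifferentiableAt ℝ (fun ζ => (G ζ).re) z)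
    (hG₁ : DifferentiableAt ℝ (fun ζ => (G ζ).im) z) :
    bpdy (fun ζ => ofC (φ ζ) * F ζ + ofC (ψ ζ) * G ζ) z =
      bpdy (fun ζ => ofC (φ ζ)) z * F z + ofC (φ z) * bpdy F z +
        (bpdy (fun ζ => ofC (ψ ζ)) z * G z + ofC (ψ z) * bpdy G z) := by
  ext
  · simp [bpdy, pdy_const, pdy_mul_add_mul hφ hF₀ hψ hG₀]
  · simp [bpdy, pdy_const, pdy_mul_add_mul hφ hF₁ hψ hG₁]

end PartialDerivatives

/-- for `W = φ·F + ψ·G`, at a point of Ω the identity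
`(∂̄φ)F + (∂̄ψ)G = 0` holds iff `∂̄W = a_(F,G)W + b_(F,G)W̄` holds there, and at such a
point `∂W − A_(F,G)W − B_(F,G)W̄ = (∂φ)F + (∂ψ)G`. -/
theorem FG_derivative_criterion
    (Ω : Set (ℝ × ℝ)) (hΩo : IsOpen Ω)
    (F G : ℝ × ℝ → Bicomplex) (hFG : IsGeneratingPair F G Ω)
    (φ ψ : ℝ × ℝ → ℂ)
    (hφ : ContDiffOn ℝ 1 φ Ω) (hψ : ContDiffOn ℝ 1 ψ Ω)
    (W : ℝ × ℝ → Bicomplex)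
    (hW : ∀ z, W z = Bicomplex.ofC (φ z) * F z + Bicomplex.ofC (ψ z) * G z)
    (z : ℝ × ℝ) (hz : z ∈ Ω) :
    ((dbar (fun ζ => Bicomplex.ofC (φ ζ)) z * F z +
        dbar (fun ζ => Bicomplex.ofC (ψ ζ)) z * G z = 0) ↔
      dbar W z = aCoef F G z * W z + bCoef F G z * Bicomplex.conj (W z)) ∧
    (dbar (fun ζ => Bicomplex.ofC (φ ζ)) z * F z +
        dbar (fun ζ => Bicomplex.ofC (ψ ζ)) z * G z = 0 →
      dz W z - ACoef F G z * W z - BCoef F G z * Bicomplex.conj (W z) =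
        dz (fun ζ => Bicomplex.ofC (φ ζ)) z * F z +
          dz (fun ζ => Bicomplex.ofC (ψ ζ)) z * G z) := by
  have hn : Ω ∈ nhds z := hΩo.mem_nhds hz
  have diff {f : ℝ × ℝ → ℂ} (hf : ContDiffOn ℝ 1 f Ω) : DifferentiableAt ℝ f z :=
    (hf.contDiffAt hn).differentiableAt one_ne_zero
  obtain ⟨⟨hF₀, hF₁⟩, ⟨hG₀, hG₁⟩, hne⟩ := hFG
  obtain rfl : W = fun ζ => Bicomplex.ofC (φ ζ) * F ζ + Bicomplex.ofC (ψ ζ) * G ζ := funext hW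
  have hx := bpdx_ofC_mul_add (diff hφ) (diff hψ) (diff hF₀) (diff hF₁) (diff hG₀) (diff hG₁)
  have hy := bpdy_ofC_mul_add (diff hφ) (diff hψ) (diff hF₀) (diff hF₁) (diff hG₀) (diff hG₁)
  have hbar := Bicomplex.characteristic_combination (hne z hz) (dbar F z) (dbar G z) (φ z) (ψ z)
  have hdz := Bicomplex.characteristic_combination (hne z hz) (dz F z) (dz G z) (φ z) (ψ z)
  refine ⟨?_, fun _ => ?_⟩
  · rw [aCoef, bCoef, hbar]
    simp only [dbar, hx, hy]
    constructor <;> intro h <;> linear_combination h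
  · rw [ACoef, BCoef, sub_sub, hdz]
    simp only [dz, hx, hy]
    ring
end

section
/- Let f0 : Ω → ℂ be a twice continuously differentiable nonvanishing complex-valued function on a domain Ω ⊆ ℝ², and let W = W₁ + W₂·k (W₁, W₂ : Ω → ℂ twice continuously differentiable) be a solution of the bicomplex Vekua equation ∂̄W = (∂̄f0/f0)·W̄ in Ω. Then W₁ = Sc(W) is a solution of the stationary Schrödinger equation −ΔW₁ + ν₁·W₁ = 0 in Ω, where ν₁ = Δf0/f0. -/
open MeasureTheory

/-- `∂̄f0/f0 = (∂f0/∂x)/f0 + k·(∂f0/∂y)/f0` as a bicomplex-valued function -/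
noncomputable def dbarLogQuot (f0 : ℝ × ℝ → ℂ) (p : ℝ × ℝ) : Bicomplex :=
  ⟨pdx f0 p / f0 p, pdy f0 p / f0 p⟩

open Filter Topology

lemma pdx_eq_of_hasFDerivAt {f : ℝ × ℝ → ℂ} {p : ℝ × ℝ} {f' : ℝ × ℝ →L[ℝ] ℂ}
    (hf : HasFDerivAt f f' p) : pdx f p = f' (1, 0) :=
  (hf.comp_hasDerivAt (x := p.1) (f := fun t => (t, p.2))
    ((hasDerivAt_id p.1).prodMk (hasDerivAt_const p.1 p.2))).deriv

lemma pdy_eq_of_hasFDerivAt {f : ℝ × ℝ → ℂ} {p : ℝ × ℝ} {f' : ℝ × ℝ →L[ℝ] ℂ}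
    (hf : HasFDerivAt f f' p) : pdy f p = f' (0, 1) :=
  (hf.comp_hasDerivAt (x := p.2) (f := fun t => (p.1, t))
    ((hasDerivAt_const p.2 p.1).prodMk (hasDerivAt_id p.2))).deriv

lemma pdx_congr {f g : ℝ × ℝ → ℂ} {p : ℝ × ℝ} (h : f =ᶠ[𝓝 p] g) : pdx f p = pdx g p := by
  have hc : Tendsto (fun t : ℝ => (t, p.2)) (𝓝 p.1) (𝓝 p) :=
    Continuous.tendsto (by fun_prop) p.1
  exact EventuallyEq.deriv_eq (hc.eventually h)

lemma pdy_congr {f g : ℝ × ℝ → ℂ} {p : ℝ × ℝ} (h : f =ᶠ[𝓝 p] g) : pdy f p = pdy g p := by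
  have hc : Tendsto (fun t : ℝ => (p.1, t)) (𝓝 p.2) (𝓝 p) :=
    Continuous.tendsto (by fun_prop) p.2
  exact EventuallyEq.deriv_eq (hc.eventually h)

lemma pdx_mul {f g : ℝ × ℝ → ℂ} {p : ℝ × ℝ} (hf : DifferentiableAt ℝ f p)
    (hg : DifferentiableAt ℝ g p) :
    pdx (fun q => f q * g q) p = pdx f p * g p + f p * pdx g p := by
  rw [pdx_eq_of_hasFDerivAt (hf.hasFDerivAt.fun_mul hg.hasFDerivAt),
    pdx_eq_of_hasFDerivAt hf.hasFDerivAt, pdx_eq_of_hasFDerivAt hg.hasFDerivAt]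
  simp
  ring

lemma pdy_mul {f g : ℝ × ℝ → ℂ} {p : ℝ × ℝ} (hf : DifferentiableAt ℝ f p)
    (hg : DifferentiableAt ℝ g p) :
    pdy (fun q => f q * g q) p = pdy f p * g p + f p * pdy g p := by
  rw [pdy_eq_of_hasFDerivAt (hf.hasFDerivAt.fun_mul hg.hasFDerivAt),
    pdy_eq_of_hasFDerivAt hf.hasFDerivAt, pdy_eq_of_hasFDerivAt hg.hasFDerivAt]
  simp
  ring

lemma pdx_sub {f g : ℝ × ℝ → ℂ} {p : ℝ × ℝ} (hf : DifferentiableAt ℝ f p)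
    (hg : DifferentiableAt ℝ g p) : pdx (fun q => f q - g q) p = pdx f p - pdx g p := by
  rw [pdx_eq_of_hasFDerivAt (hf.hasFDerivAt.fun_sub hg.hasFDerivAt),
    pdx_eq_of_hasFDerivAt hf.hasFDerivAt, pdx_eq_of_hasFDerivAt hg.hasFDerivAt]
  simp

lemma pdy_sub {f g : ℝ × ℝ → ℂ} {p : ℝ × ℝ} (hf : DifferentiableAt ℝ f p)
    (hg : DifferentiableAt ℝ g p) : pdy (fun q => f q - g q) p = pdy f p - pdy g p := by
  rw [pdy_eq_of_hasFDerivAt (hf.hasFDerivAt.fun_sub hg.hasFDerivAt),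
    pdy_eq_of_hasFDerivAt hf.hasFDerivAt, pdy_eq_of_hasFDerivAt hg.hasFDerivAt]
  simp

lemma ContDiffAt.pdx_eventuallyEq_fderiv {f : ℝ × ℝ → ℂ} {p : ℝ × ℝ} (hf : ContDiffAt ℝ 2 f p) :
    pdx f =ᶠ[𝓝 p] fun q => fderiv ℝ f q (1, 0) := by
  filter_upwards [hf.eventually (by simp)] with q hq
  exact pdx_eq_of_hasFDerivAt (hq.differentiableAt two_ne_zero).hasFDerivAt

lemma ContDiffAt.pdy_eventuallyEq_fderiv {f : ℝ × ℝ → ℂ} {p : ℝ × ℝ} (hf : ContDiffAt ℝ 2 f p) :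
    pdy f =ᶠ[𝓝 p] fun q => fderiv ℝ f q (0, 1) := by
  filter_upwards [hf.eventually (by simp)] with q hq
  exact pdy_eq_of_hasFDerivAt (hq.differentiableAt two_ne_zero).hasFDerivAt

lemma ContDiffAt.hasFDerivAt_fderiv_apply {f : ℝ × ℝ → ℂ} {p : ℝ × ℝ}
    (hf : ContDiffAt ℝ 2 f p) (v : ℝ × ℝ) :
    HasFDerivAt (fun q => fderiv ℝ f q v) ((fderiv ℝ (fderiv ℝ f) p).flip v) p := by
  have h : DifferentiableAt ℝ (fderiv ℝ f) p :=
    (hf.fderiv_right (m := 1) (by norm_num)).differentiableAt one_ne_zero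
  exact (ContinuousLinearMap.apply ℝ ℂ v).hasFDerivAt.comp p h.hasFDerivAt

lemma ContDiffAt.differentiableAt_pdx {f : ℝ × ℝ → ℂ} {p : ℝ × ℝ} (hf : ContDiffAt ℝ 2 f p) :
    DifferentiableAt ℝ (pdx f) p :=
  (hf.hasFDerivAt_fderiv_apply (1, 0)).differentiableAt.congr_of_eventuallyEq
    hf.pdx_eventuallyEq_fderiv

lemma ContDiffAt.differentiableAt_pdy {f : ℝ × ℝ → ℂ} {p : ℝ × ℝ} (hf : ContDiffAt ℝ 2 f p) :
    DifferentiableAt ℝ (pdy f) p :=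
  (hf.hasFDerivAt_fderiv_apply (0, 1)).differentiableAt.congr_of_eventuallyEq
    hf.pdy_eventuallyEq_fderiv

lemma ContDiffAt.pdx_pdy_eq_pdy_pdx {f : ℝ × ℝ → ℂ} {p : ℝ × ℝ} (hf : ContDiffAt ℝ 2 f p) :
    pdx (pdy f) p = pdy (pdx f) p := by
  rw [pdx_congr hf.pdy_eventuallyEq_fderiv, pdy_congr hf.pdx_eventuallyEq_fderiv,
    pdx_eq_of_hasFDerivAt (hf.hasFDerivAt_fderiv_apply _),
    pdy_eq_of_hasFDerivAt (hf.hasFDerivAt_fderiv_apply _)]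
  exact hf.isSymmSndFDerivAt (by simp) (1, 0) (0, 1)

/-- If `f·∇u - u·∇f` is the rotated gradient `(∂g/∂y, -∂g/∂x)` of a `C²` function `g`,
then it is divergence free. -/
lemma mul_lap_eq_of_eventually_conjugate {f u g : ℝ × ℝ → ℂ} {p : ℝ × ℝ}
    (hf : ContDiffAt ℝ 2 f p) (hu : ContDiffAt ℝ 2 u p) (hg : ContDiffAt ℝ 2 g p)
    (hx : ∀ᶠ q in 𝓝 p, pdy g q = f q * pdx u q - u q * pdx f q)
    (hy : ∀ᶠ q in 𝓝 p, pdx g q = u q * pdy f q - f q * pdy u q) :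
    f p * lap u p = u p * lap f p := by
  have hf' := hf.differentiableAt two_ne_zero
  have hu' := hu.differentiableAt two_ne_zero
  have h := hg.pdx_pdy_eq_pdy_pdx
  rw [pdx_congr hx, pdy_congr hy,
    pdx_sub (hf'.fun_mul hu.differentiableAt_pdx) (hu'.fun_mul hf.differentiableAt_pdx),
    pdy_sub (hu'.fun_mul hf.differentiableAt_pdy) (hf'.fun_mul hu.differentiableAt_pdy),
    pdx_mul hf' hu.differentiableAt_pdx, pdx_mul hu' hf.differentiableAt_pdx,
    pdy_mul hu' hf.differentiableAt_pdy, pdy_mul hf' hu.differentiableAt_pdy] at h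
  unfold lap
  linear_combination h

lemma dbar_eq_dbarLogQuot_mul_conj_iff {f W₁ W₂ : ℝ × ℝ → ℂ} {p : ℝ × ℝ} :
    dbar (fun q => (⟨W₁ q, W₂ q⟩ : Bicomplex)) p =
        dbarLogQuot f p * Bicomplex.conj ⟨W₁ p, W₂ p⟩ ↔
      pdx W₁ p - pdy W₂ p = pdx f p / f p * W₁ p + pdy f p / f p * W₂ p ∧
      pdx W₂ p + pdy W₁ p = pdy f p / f p * W₁ p - pdx f p / f p * W₂ p := by
  change Bicomplex.mk (pdx W₁ p + (0 * pdy W₁ p - 1 * pdy W₂ p))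
      (pdx W₂ p + (0 * pdy W₂ p + 1 * pdy W₁ p)) =
    Bicomplex.mk (pdx f p / f p * W₁ p - pdy f p / f p * -W₂ p)
      (pdx f p / f p * -W₂ p + pdy f p / f p * W₁ p) ↔ _
  rw [Bicomplex.mk.injEq]
  ring_nf

/-- if `W = W₁ + W₂·k` solves `∂̄W = (∂̄f0/f0)·W̄` in Ω then `W₁ = Sc W`
solves the stationary Schrödinger equation `−ΔW₁ + ν₁W₁ = 0` with `ν₁ = Δf0/f0`. -/
theorem scalar_part_solves_Schroedinger
    (Ω : Set (ℝ × ℝ)) (hΩo : IsOpen Ω) (hΩc : IsConnected Ω)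
    (f0 : ℝ × ℝ → ℂ) (hf0 : ContDiffOn ℝ 2 f0 Ω) (hf0ne : ∀ p ∈ Ω, f0 p ≠ 0)
    (W₁ W₂ : ℝ × ℝ → ℂ)
    (hW₁ : ContDiffOn ℝ 2 W₁ Ω) (hW₂ : ContDiffOn ℝ 2 W₂ Ω)
    (hVek : ∀ p ∈ Ω,
      dbar (fun q => (⟨W₁ q, W₂ q⟩ : Bicomplex)) p =
        dbarLogQuot f0 p * Bicomplex.conj ⟨W₁ p, W₂ p⟩) :
    ∀ p ∈ Ω, -lap W₁ p + (lap f0 p / f0 p) * W₁ p = 0 := by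
  intro p hp
  have hd : ∀ q ∈ Ω, DifferentiableAt ℝ f0 q ∧ DifferentiableAt ℝ W₂ q := fun q hq =>
    ⟨(hf0.contDiffAt (hΩo.mem_nhds hq)).differentiableAt two_ne_zero,
      (hW₂.contDiffAt (hΩo.mem_nhds hq)).differentiableAt two_ne_zero⟩
  have hf := hf0.contDiffAt (hΩo.mem_nhds hp)
  have key : f0 p * lap W₁ p = W₁ p * lap f0 p := by
    refine mul_lap_eq_of_eventually_conjugate (g := fun q => f0 q * W₂ q) hf
      (hW₁.contDiffAt (hΩo.mem_nhds hp)) (hf.mul (hW₂.contDiffAt (hΩo.mem_nhds hp))) ?_ ?_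
    · filter_upwards [hΩo.mem_nhds hp] with q hq
      have h := (dbar_eq_dbarLogQuot_mul_conj_iff.1 (hVek q hq)).1
      have hne := hf0ne q hq
      rw [pdy_mul (hd q hq).1 (hd q hq).2]
      field_simp at h
      linear_combination -h
    · filter_upwards [hΩo.mem_nhds hp] with q hq
      have h := (dbar_eq_dbarLogQuot_mul_conj_iff.1 (hVek q hq)).2
      have hne := hf0ne q hq
      rw [pdx_mul (hd q hq).1 (hd q hq).2]
      field_simp at h
      linear_combination h
  have hne := hf0ne p hp
  field_simp
  linear_combination -key
end

section
/- Let Ĝ ⊆ ℝ³ be a domain, ω, m ∈ ℝ, and p_el, p_sc, A₁, A₂, A₃ : Ĝ → ℝ. Let 𝔻_ω = iω·γ₀ + Σ_{k=1}^{3} γₖ·∂ₖ + i(m + p_el·γ₀ + Σ_{k=1}^{3} Aₖ·γₖ + p_sc) acting on differentiable functions Φ : Ĝ → ℂ⁴, with γ-matrices in the standard Dirac representation. Let G̃ be the image of Ĝ under the reflection (x₁,x₂,x₃) ↦ (x₁,x₂,−x₃), and for a function f on Ĝ write f̃(x₁,x₂,x₃) = f(x₁,x₂,−x₃). Let R_ω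 = D + a + M^b act on differentiable ℍ(ℂ)-valued functions on G̃, where a = i(Ã₁e₁ + Ã₂e₂ − Ã₃e₃) and b = −i((p̃_el + ω)e₁ − i(p̃_sc + m)e₂). Then a differentiable Φ : Ĝ → ℂ⁴ satisfies 𝔻_ωΦ = 0 in Ĝ if and only if the ℍ(ℂ)-valued function F = 𝒜[Φ] satisfies R_ωF = DF + a·F + F·b = 0 in G̃, where 𝒜[Φ] = ½(−(Φ̃₁ − Φ̃₂)e₀ + i(Φ̃₀ − Φ̃₃)e₁ − (Φ̃₀ + Φ̃₃)e₂ + i(Φ̃₁ + Φ̃₂)e₃) (components of Φ indexed 0,1,2,3). -/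
open scoped Quaternion

/-- points of ℝ³ -/
abbrev R3 := Fin 3 → ℝ

/-- partial derivative ∂ⱼ of a complex-valued function on ℝ³ -/
noncomputable def pd (j : Fin 3) (f : R3 → ℂ) (x : R3) : ℂ :=
  deriv (fun t => f (Function.update x j t)) (x j)

/-- partial derivative ∂ⱼ of a complex-quaternion-valued function (componentwise) -/
noncomputable def pdQ (j : Fin 3) (F : R3 → ℍ[ℂ]) (x : R3) : ℍ[ℂ] :=
  ⟨pd j (fun y => (F y).re) x, pd j (fun y => (F y).imI) x,
   pd j (fun y => (F y).imJ) x, pd j (fun y => (F y).imK) x⟩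

/-- quaternionic unit e₁ -/
def e₁ : ℍ[ℂ] := ⟨0, 1, 0, 0⟩
/-- quaternionic unit e₂ -/
def e₂ : ℍ[ℂ] := ⟨0, 0, 1, 0⟩
/-- quaternionic unit e₃ -/
def e₃ : ℍ[ℂ] := ⟨0, 0, 0, 1⟩

/-- the Moisil–Theodorescu (Dirac) operator `D = e₁∂₁ + e₂∂₂ + e₃∂₃` -/
noncomputable def Dmt (F : R3 → ℍ[ℂ]) (x : R3) : ℍ[ℂ] :=
  e₁ * pdQ 0 F x + e₂ * pdQ 1 F x + e₃ * pdQ 2 F x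

/-- componentwise differentiability of an ℍ(ℂ)-valued function on a set -/
def QDifferentiableOn (F : R3 → ℍ[ℂ]) (Ω : Set R3) : Prop :=
  DifferentiableOn ℝ (fun x => (F x).re) Ω ∧ DifferentiableOn ℝ (fun x => (F x).imI) Ω ∧
  DifferentiableOn ℝ (fun x => (F x).imJ) Ω ∧ DifferentiableOn ℝ (fun x => (F x).imK) Ω

/-- γ₀ in the standard Dirac representation -/
noncomputable def gamma0 : Matrix (Fin 4) (Fin 4) ℂ :=
  !![1, 0, 0, 0; 0, 1, 0, 0; 0, 0, -1, 0; 0, 0, 0, -1]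

/-- γ₁, γ₂, γ₃ in the standard Dirac representation -/
noncomputable def gam : Fin 3 → Matrix (Fin 4) (Fin 4) ℂ :=
  ![!![0, 0, 0, 1; 0, 0, 1, 0; 0, -1, 0, 0; -1, 0, 0, 0],
    !![0, 0, 0, -Complex.I; 0, 0, Complex.I, 0; 0, Complex.I, 0, 0; -Complex.I, 0, 0, 0],
    !![0, 0, 1, 0; 0, 0, 0, -1; -1, 0, 0, 0; 0, 1, 0, 0]]

/-- the Dirac operator with fixed energy ω:
`𝔻_ω = iωγ₀ + Σ γₖ∂ₖ + i(m + p_el γ₀ + Σ Aₖγₖ + p_sc)` -/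
noncomputable def DiracOmega (ω m : ℝ) (pel psc : R3 → ℝ) (A : Fin 3 → R3 → ℝ)
    (Φ : R3 → Fin 4 → ℂ) (x : R3) : Fin 4 → ℂ :=
  (Complex.I * (ω : ℂ)) • gamma0.mulVec (Φ x)
    + ∑ j : Fin 3, (gam j).mulVec (fun l => pd j (fun y => Φ y l) x)
    + Complex.I • (((m : ℂ) + (psc x : ℂ)) • Φ x
        + (pel x : ℂ) • gamma0.mulVec (Φ x)
        + ∑ j : Fin 3, ((A j x : ℂ)) • (gam j).mulVec (Φ x))

/-- the reflection `(x₁,x₂,x₃) ↦ (x₁,x₂,−x₃)` -/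
def reflx (x : R3) : R3 := Function.update x 2 (-(x 2))

/-- the transformation `𝒜` sending a ℂ⁴-valued function to an ℍ(ℂ)-valued one:
`𝒜[Φ] = ½(−(Φ̃₁−Φ̃₂)e₀ + i(Φ̃₀−Φ̃₃)e₁ − (Φ̃₀+Φ̃₃)e₂ + i(Φ̃₁+Φ̃₂)e₃)` -/
noncomputable def transA (Φ : R3 → Fin 4 → ℂ) (x : R3) : ℍ[ℂ] :=
  ((2 : ℂ)⁻¹) •
    (⟨-(Φ (reflx x) 1 - Φ (reflx x) 2),
      Complex.I * (Φ (reflx x) 0 - Φ (reflx x) 3),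
      -(Φ (reflx x) 0 + Φ (reflx x) 3),
      Complex.I * (Φ (reflx x) 1 + Φ (reflx x) 2)⟩ : ℍ[ℂ])

/-- `a = i(Ã₁e₁ + Ã₂e₂ − Ã₃e₃)` -/
noncomputable def aPot (A : Fin 3 → R3 → ℝ) (x : R3) : ℍ[ℂ] :=
  Complex.I • (((A 0 (reflx x) : ℝ) : ℂ) • e₁ + ((A 1 (reflx x) : ℝ) : ℂ) • e₂
    - ((A 2 (reflx x) : ℝ) : ℂ) • e₃)

/-- `b = −i((p̃_el + ω)e₁ − i(p̃_sc + m)e₂)` -/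
noncomputable def bPot (ω m : ℝ) (pel psc : R3 → ℝ) (x : R3) : ℍ[ℂ] :=
  (-Complex.I) • (((pel (reflx x) + ω : ℝ) : ℂ) • e₁
    - Complex.I • (((psc (reflx x) + m : ℝ) : ℂ) • e₂))

/-- The partial derivative of a differentiable function is a genuine derivative along the
coordinate line. -/
theorem hasDerivAt_pd {f : R3 → ℂ} {x : R3} (hf : DifferentiableAt ℝ f x) (j : Fin 3) :
    HasDerivAt (fun t => f (Function.update x j t)) (pd j f x) (x j) := by
  refine DifferentiableAt.hasDerivAt ?_
  refine DifferentiableAt.comp (x j) (g := f) ?_ (hasDerivAt_update x j (x j)).differentiableAt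
  simpa using hf

theorem reflx_reflx (x : R3) : reflx (reflx x) = x := by
  simp [reflx]

/-- The sign picked up by `∂ⱼ` under the reflection. -/
def reflSign (j : Fin 3) : ℝ := if j = 2 then -1 else 1

theorem reflx_update (x : R3) (j : Fin 3) (t : ℝ) :
    reflx (Function.update (reflx x) j t) = Function.update x j (reflSign j * t) := by
  ext k
  fin_cases j <;> fin_cases k <;> simp [reflx, reflSign]

theorem reflSign_mul_reflx (x : R3) (j : Fin 3) : reflSign j * reflx x j = x j := by
  fin_cases j <;> simp [reflx, reflSign]

/-- Chain rule for partial derivatives under the reflection. -/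
theorem hasDerivAt_comp_reflx {f : R3 → ℂ} {x : R3} (hf : DifferentiableAt ℝ f x) (j : Fin 3) :
    HasDerivAt (fun t => f (reflx (Function.update (reflx x) j t)))
      ((reflSign j : ℂ) * pd j f x) (reflx x j) := by
  simp only [reflx_update]
  have h := hasDerivAt_pd hf j
  rw [← reflSign_mul_reflx x j] at h
  have hc := h.scomp (reflx x j) ((hasDerivAt_id (reflx x j)).const_mul (reflSign j))
  rwa [mul_one, Complex.real_smul] at hc

/-- Partial derivatives of `𝒜[Φ]` at a reflected point. -/
theorem pdQ_transA {Φ : R3 → Fin 4 → ℂ} {x : R3}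
    (hΦ : ∀ l, DifferentiableAt ℝ (fun y => Φ y l) x) (j : Fin 3) :
    pdQ j (transA Φ) (reflx x) = ((2 : ℂ)⁻¹ * (reflSign j : ℂ)) •
      (⟨-(pd j (fun y => Φ y 1) x - pd j (fun y => Φ y 2) x),
        Complex.I * (pd j (fun y => Φ y 0) x - pd j (fun y => Φ y 3) x),
        -(pd j (fun y => Φ y 0) x + pd j (fun y => Φ y 3) x),
        Complex.I * (pd j (fun y => Φ y 1) x + pd j (fun y => Φ y 2) x)⟩ : ℍ[ℂ]) := by
  have h := fun l => hasDerivAt_comp_reflx (hΦ l) j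
  ext
  · refine ((((h 1).sub (h 2)).neg).const_mul (2 : ℂ)⁻¹).deriv.trans ?_
    simp only [QuaternionAlgebra.re_smul, smul_eq_mul]
    ring
  · refine ((((h 0).sub (h 3)).const_mul Complex.I).const_mul (2 : ℂ)⁻¹).deriv.trans ?_
    simp only [QuaternionAlgebra.imI_smul, smul_eq_mul]
    ring
  · refine ((((h 0).add (h 3)).neg).const_mul (2 : ℂ)⁻¹).deriv.trans ?_
    simp only [QuaternionAlgebra.imJ_smul, smul_eq_mul]
    ring
  · refine ((((h 1).add (h 2)).const_mul Complex.I).const_mul (2 : ℂ)⁻¹).deriv.trans ?_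
    simp only [QuaternionAlgebra.imK_smul, smul_eq_mul]
    ring

theorem aPot_reflx (A : Fin 3 → R3 → ℝ) (x : R3) :
    aPot A (reflx x) = ⟨0, Complex.I * A 0 x, Complex.I * A 1 x, -(Complex.I * A 2 x)⟩ := by
  ext <;> simp [aPot, reflx_reflx] <;> simp [e₁, e₂, e₃]

theorem bPot_reflx (ω m : ℝ) (pel psc : R3 → ℝ) (x : R3) :
    bPot ω m pel psc (reflx x) = ⟨0, -(Complex.I * (pel x + ω)), -(psc x + m), 0⟩ := by
  ext <;> simp [bPot, reflx_reflx] <;> simp [e₁, e₂, ← mul_assoc]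

/-- The quaternionic operator applied to `𝒜[Φ]` is an invertible linear image of `𝔻_ωΦ`. -/
theorem quaternionic_operator_transA (ω m : ℝ) (pel psc : R3 → ℝ) (A : Fin 3 → R3 → ℝ)
    {Φ : R3 → Fin 4 → ℂ} {x : R3} (hΦ : ∀ l, DifferentiableAt ℝ (fun y => Φ y l) x) :
    Dmt (transA Φ) (reflx x) + aPot A (reflx x) * transA Φ (reflx x)
        + transA Φ (reflx x) * bPot ω m pel psc (reflx x) =
      (2 : ℂ)⁻¹ •
        (⟨Complex.I * (DiracOmega ω m pel psc A Φ x 0 + DiracOmega ω m pel psc A Φ x 3),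
          DiracOmega ω m pel psc A Φ x 1 + DiracOmega ω m pel psc A Φ x 2,
          Complex.I * (DiracOmega ω m pel psc A Φ x 2 - DiracOmega ω m pel psc A Φ x 1),
          DiracOmega ω m pel psc A Φ x 3 - DiracOmega ω m pel psc A Φ x 0⟩ : ℍ[ℂ]) := by
  ext <;>
  · simp only [Dmt, Quaternion.re_add, Quaternion.imI_add, Quaternion.imJ_add, Quaternion.imK_add,
      Quaternion.re_mul, Quaternion.imI_mul, Quaternion.imJ_mul, Quaternion.imK_mul]
    simp only [pdQ_transA hΦ, aPot_reflx, bPot_reflx]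
    simp [transA, reflx_reflx, e₁, e₂, e₃, reflSign, DiracOmega, gamma0, gam,
      dotProduct, Fin.sum_univ_succ, Matrix.vecHead, Matrix.vecTail]
    ring_nf <;> simp only [Complex.I_sq, Complex.I_pow_three] <;> ring

/-- The linear change of unknowns between the two residuals is injective. -/
theorem smul_residual_eq_zero_iff (r : Fin 4 → ℂ) :
    (2 : ℂ)⁻¹ • (⟨Complex.I * (r 0 + r 3), r 1 + r 2, Complex.I * (r 2 - r 1), r 3 - r 0⟩ : ℍ[ℂ])
      = 0 ↔ r = 0 := by
  constructor
  · intro h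
    have h₀ : r 0 + r 3 = 0 := by simpa using congrArg QuaternionAlgebra.re h
    have h₁ : r 1 + r 2 = 0 := by simpa using congrArg QuaternionAlgebra.imI h
    have h₂ : r 2 - r 1 = 0 := by simpa using congrArg QuaternionAlgebra.imJ h
    have h₃ : r 3 - r 0 = 0 := by simpa using congrArg QuaternionAlgebra.imK h
    ext k
    fin_cases k <;> simp only [Pi.zero_apply] <;> grind
  · rintro rfl
    ext <;> simp

/-- `Φ` solves the Dirac equation `𝔻_ωΦ = 0` in Ghat iff `F = 𝒜[Φ]`
solves the quaternionic equation `R_ωF = DF + a·F + F·b = 0` in G̃. -/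
theorem Dirac_quaternionic_reformulation
    (Ghat : Set R3) (hG : IsOpen Ghat) (ω m : ℝ)
    (pel psc : R3 → ℝ) (A : Fin 3 → R3 → ℝ)
    (Φ : R3 → Fin 4 → ℂ) (hΦ : ∀ j : Fin 4, DifferentiableOn ℝ (fun x => Φ x j) Ghat) :
    (∀ x ∈ Ghat, DiracOmega ω m pel psc A Φ x = 0) ↔
      (∀ x ∈ reflx '' Ghat,
        Dmt (transA Φ) x + aPot A x * transA Φ x
          + transA Φ x * bPot ω m pel psc x = 0) := by
  rw [Set.forall_mem_image]
  refine forall₂_congr fun x hx => ?_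
  have hd : ∀ l, DifferentiableAt ℝ (fun y => Φ y l) x :=
    fun l => (hΦ l).differentiableAt (hG.mem_nhds hx)
  rw [quaternionic_operator_transA ω m pel psc A hd]
  exact (smul_residual_eq_zero_iff (DiracOmega ω m pel psc A Φ x)).symm
end

section
/- Let Ω ⊆ ℝ³ be a domain, and suppose in the setting of the quaternionic equation Dq + a·q + q·b = 0 that a₃ ≡ 0 (so 𝒜₁ ≡ 0) and that a₁, a₂, B and the solution q are independent of x₃. Then the system D₁Q₁ − D₂Q̄₂ + 𝒜₁Q₁ − 𝒜₂Q̄₂ − B̄Q₂ = 0, D₂Q̄₁ + D₁Q₂ + 𝒜₂Q̄₁ + 𝒜₁Q₂ + BQ₁ = 0 decouples: it holds if and only if w = Q₂ satisfies ∂̄w = 𝐚·w + 𝐛·w̄ and W = Q₁ satisfies ∂̄W = 𝐚·W + conj(𝐛·W), where ∂̄ = ∂₂ + e₃∂₁ (the conjugate of D₂ = ∂₂ − e₃∂₁), 𝐚 = −𝒜̄₂ = −(a₂ + a₁e₃), 𝐛 = −B, and conj denotes the bicomplex conjugation sending e₃ to −e₃. -/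
open scoped Quaternion

/-- partial derivative ∂ⱼ of a bicomplex-valued function on ℝ³ (componentwise) -/
noncomputable def bpd (j : Fin 3) (Q : R3 → Bicomplex) (x : R3) : Bicomplex :=
  ⟨pd j (fun y => (Q y).re) x, pd j (fun y => (Q y).im) x⟩

/-- `D₁ = e₃∂₃` -/
noncomputable def D1 (Q : R3 → Bicomplex) (x : R3) : Bicomplex :=
  Bicomplex.k * bpd 2 Q x

/-- `D₂ = ∂₂ − e₃∂₁` -/
noncomputable def D2 (Q : R3 → Bicomplex) (x : R3) : Bicomplex :=
  bpd 1 Q x - Bicomplex.k * bpd 0 Q x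

/-- first bicomplex component `Q₁ = q₀ + q₃e₃` of a complex quaternion -/
def Qone (q : ℍ[ℂ]) : Bicomplex := ⟨q.re, q.imK⟩
/-- second bicomplex component `Q₂ = q₂ − q₁e₃` of a complex quaternion -/
def Qtwo (q : ℍ[ℂ]) : Bicomplex := ⟨q.imJ, -q.imI⟩

/-- `∂̄ = ∂₂ + e₃∂₁`, the conjugate of `D₂ = ∂₂ − e₃∂₁` -/
noncomputable def dbar3 (Q : R3 → Bicomplex) (x : R3) : Bicomplex :=
  bpd 1 Q x + Bicomplex.k * bpd 0 Q x

@[simp] theorem Bicomplex.add_re_s12 (p q : Bicomplex) : (p + q).re = p.re + q.re := rfl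

@[simp] theorem Bicomplex.add_im_s12 (p q : Bicomplex) : (p + q).im = p.im + q.im := rfl

@[simp] theorem Bicomplex.sub_re_s12 (p q : Bicomplex) : (p - q).re = p.re - q.re := rfl

@[simp] theorem Bicomplex.sub_im_s12 (p q : Bicomplex) : (p - q).im = p.im - q.im := rfl

@[simp] theorem Bicomplex.neg_re_s12 (p : Bicomplex) : (-p).re = -p.re := rfl

@[simp] theorem Bicomplex.zero_re_s12 : (0 : Bicomplex).re = 0 := rfl

@[simp] theorem Bicomplex.neg_im_s12 (p : Bicomplex) : (-p).im = -p.im := rfl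

@[simp] theorem Bicomplex.zero_im_s12 : (0 : Bicomplex).im = 0 := rfl

@[simp] theorem Bicomplex.mul_re_s12 (p q : Bicomplex) :
    (p * q).re = p.re * q.re - p.im * q.im := rfl

@[simp] theorem Bicomplex.mul_im_s12 (p q : Bicomplex) :
    (p * q).im = p.re * q.im + p.im * q.re := rfl

theorem Bicomplex.ext_iff_re_im {p q : Bicomplex} : p = q ↔ p.re = q.re ∧ p.im = q.im := by
  cases p; cases q; simp

/-- The operator `D₂` is the bicomplex conjugate of `∂̄`. -/
theorem D2_conj (Q : R3 → Bicomplex) (x : R3) :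
    D2 (fun y => Bicomplex.conj (Q y)) x = Bicomplex.conj (dbar3 Q x) := by
  have hneg : ∀ j : Fin 3, pd j (fun y => -(Q y).im) x = -pd j (fun y => (Q y).im) x :=
    fun j => deriv.fun_neg
  simp only [Bicomplex.ext_iff_re_im, D2, dbar3, bpd, Bicomplex.conj, Bicomplex.k, hneg,
    Bicomplex.sub_re_s12, Bicomplex.sub_im_s12, Bicomplex.add_re_s12, Bicomplex.add_im_s12, Bicomplex.mul_re_s12,
    Bicomplex.mul_im_s12]
  constructor <;> ring

/-- `D₁` annihilates functions that do not depend on `x₃`. -/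
theorem D1_eq_zero {Q : R3 → Bicomplex}
    (hQ : ∀ (x : R3) (t : ℝ), Q (Function.update x 2 t) = Q x) (x : R3) : D1 Q x = 0 := by
  have hbpd : bpd 2 Q x = 0 := by
    simp only [bpd, pd, hQ, deriv_const]
    rfl
  rw [D1, hbpd]
  simp [Bicomplex.ext_iff_re_im, Bicomplex.k]

/-- if `a₃ ≡ 0` (so `𝒜₁ ≡ 0`) and `a₁, a₂, B` and the solution `q` are
independent of `x₃`, then the bicomplex system decouples: it holds iff `w = Q₂`
satisfies `∂̄w = 𝐚w + 𝐛w̄` and `W = Q₁` satisfies `∂̄W = 𝐚W + conj(𝐛W)`, where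
`∂̄ = ∂₂ + e₃∂₁`, `𝐚 = −𝒜̄₂ = −(a₂ + a₁e₃)` and `𝐛 = −B`. -/
theorem bicomplex_system_decouples
    (Ω : Set R3) (hΩ : IsOpen Ω)
    (q : R3 → ℍ[ℂ]) (hq : QDifferentiableOn q Ω)
    (a1 a2 a3 : R3 → ℂ) (B : R3 → Bicomplex)
    (ha3 : ∀ x, a3 x = 0)
    (ha1ind : ∀ (x : R3) (t : ℝ), a1 (Function.update x 2 t) = a1 x)
    (ha2ind : ∀ (x : R3) (t : ℝ), a2 (Function.update x 2 t) = a2 x)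
    (hBind : ∀ (x : R3) (t : ℝ), B (Function.update x 2 t) = B x)
    (hqind : ∀ (x : R3) (t : ℝ), q (Function.update x 2 t) = q x) :
    let Q1 : R3 → Bicomplex := fun x => Qone (q x)
    let Q2 : R3 → Bicomplex := fun x => Qtwo (q x)
    let A1 : R3 → Bicomplex := fun x => ⟨0, a3 x⟩
    let A2 : R3 → Bicomplex := fun x => ⟨a2 x, -a1 x⟩
    let av : R3 → Bicomplex := fun x => ⟨-a2 x, -a1 x⟩
    let bv : R3 → Bicomplex := fun x => -B x
    (∀ x ∈ Ω,
        D1 Q1 x - D2 (fun y => Bicomplex.conj (Q2 y)) x + A1 x * Q1 x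
            - A2 x * Bicomplex.conj (Q2 x) - Bicomplex.conj (B x) * Q2 x = 0 ∧
        D2 (fun y => Bicomplex.conj (Q1 y)) x + D1 Q2 x + A2 x * Bicomplex.conj (Q1 x)
            + A1 x * Q2 x + B x * Q1 x = 0) ↔
      (∀ x ∈ Ω,
        dbar3 Q2 x = av x * Q2 x + bv x * Bicomplex.conj (Q2 x) ∧
        dbar3 Q1 x = av x * Q1 x + Bicomplex.conj (bv x * Q1 x)) := by
  intro Q1 Q2 A1 A2 av bv
  refine forall₂_congr fun x _ => ?_
  have hQ1 : D1 Q1 x = 0 := D1_eq_zero (fun x t => congrArg Qone (hqind x t)) x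
  have hQ2 : D1 Q2 x = 0 := D1_eq_zero (fun x t => congrArg Qtwo (hqind x t)) x
  rw [hQ1, hQ2, D2_conj, D2_conj]
  simp only [A1, A2, av, bv, ha3]
  generalize dbar3 Q1 x = d1, dbar3 Q2 x = d2, Q1 x = w1, Q2 x = w2, B x = b
  simp only [Bicomplex.ext_iff_re_im, Bicomplex.conj, Bicomplex.sub_re_s12, Bicomplex.sub_im_s12,
    Bicomplex.add_re_s12, Bicomplex.add_im_s12, Bicomplex.mul_re_s12, Bicomplex.mul_im_s12, Bicomplex.neg_re_s12,
    Bicomplex.neg_im_s12, Bicomplex.zero_re_s12, Bicomplex.zero_im_s12]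
  constructor
  · rintro ⟨⟨h1, h2⟩, h3, h4⟩
    refine ⟨⟨?_, ?_⟩, ?_, ?_⟩
    · linear_combination -h1
    · linear_combination h2
    · linear_combination h3
    · linear_combination -h4
  · rintro ⟨⟨h1, h2⟩, h3, h4⟩
    refine ⟨⟨?_, ?_⟩, ?_, ?_⟩
    · linear_combination -h1
    · linear_combination h2
    · linear_combination h3
    · linear_combination -h4
end
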